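/- arXiv:1904.01031 — 7 statements merged into one kernel-verified Lean document; each statement's English description precedes it below -/
import Mathlib

section
/- Suppose f : List β → D is memoryless via g : β → D and ⊕ : D → D → D, i.e., f(σ • [δ]) = f(σ) ⊕ g(δ) for all σ : List β and δ : β, and let h : List D → D, defined by h(x) = List.foldl ⊕ (f []) x, be the summarized version of f. If h is ⊙-homomorphic for some binary operator ⊙ : D → D → D, i.e., h(x • y) = h(x) ⊙ h(y) for all x, y : List D, then f is ⊙-homomorphic, i.e., f(σ • σ') = f(σ) ⊙ f(σ') for all σ, σ' : List β. -/
theorem summarized_hom_implies_hom {β D : Type*} (f : List β → D) (g : β → D)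
    (op : D → D → D)
    (hmem : ∀ (σ : List β) (δ : β), f (σ ++ [δ]) = op (f σ) (g δ))
    (odot : D → D → D)
    (hhom : ∀ x y : List D,
      List.foldl op (f []) (x ++ y) =
        odot (List.foldl op (f []) x) (List.foldl op (f []) y)) :
    ∀ σ σ' : List β, f (σ ++ σ') = odot (f σ) (f σ') := by
  have key : ∀ σ : List β, f σ = List.foldl op (f []) (σ.map g) := by
    intro σ
    induction σ using List.reverseRecOn with
    | nil => rfl
    | append_singleton l a ih =>
      rw [hmem, List.map_append, List.foldl_append, ← ih]
      rfl
  intro σ σ'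
  rw [key (σ ++ σ'), List.map_append, hhom, ← key, ← key]
end

section
/- Let f : List β → D and ⊙ : D → D → D. Define g : β → D by g(δ) = f([δ]) and h : List D → D by h(x) = List.foldl ⊙ (f []) x. Then the following two statements are equivalent: (1) f is ⊙-homomorphic, i.e., f(σ • σ') = f(σ) ⊙ f(σ') for all σ, σ' : List β; (2) f is memoryless with respect to ⊙ and g, i.e., f(σ • [δ]) = f(σ) ⊙ g(δ) for all σ : List β and δ : β, AND the summarized function h is ⊙-homomorphic on sequences arising from g, i.e., h((σs.map g) • (σs'.map g)) = h(σs.map g) ⊙ h(σs'.map g) for all σs, σs' : List β. -/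
theorem hom_iff_memoryless_and_summarized_hom {β D : Type*}
    (f : List β → D) (odot : D → D → D) :
    (∀ σ σ' : List β, f (σ ++ σ') = odot (f σ) (f σ')) ↔
      ((∀ (σ : List β) (δ : β), f (σ ++ [δ]) = odot (f σ) (f [δ])) ∧
       (∀ σs σs' : List β,
         List.foldl odot (f []) ((σs.map fun δ => f [δ]) ++ (σs'.map fun δ => f [δ])) =
           odot (List.foldl odot (f []) (σs.map fun δ => f [δ]))
             (List.foldl odot (f []) (σs'.map fun δ => f [δ])))) := by
  have key : (∀ (σ : List β) (δ : β), f (σ ++ [δ]) = odot (f σ) (f [δ])) →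
      ∀ σ : List β, List.foldl odot (f []) (σ.map fun δ => f [δ]) = f σ := by
    intro hm σ
    induction σ using List.reverseRecOn with
    | nil => rfl
    | append_singleton l a ih =>
      rw [List.map_append, List.foldl_append, ih, hm l a]
      rfl
  constructor
  · intro h
    have hm : ∀ (σ : List β) (δ : β), f (σ ++ [δ]) = odot (f σ) (f [δ]) := fun σ δ => h σ [δ]
    refine ⟨hm, fun a b => ?_⟩
    rw [← List.map_append, key hm, key hm, key hm, h]
  · rintro ⟨hm, h⟩ a b
    have := h a b
    rwa [← List.map_append, key hm, key hm, key hm] at this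
end

section
/- Let f : List β → D be memoryless via g : β → D and ⊕ : D → D → D, i.e., f(σ • [δ]) = f(σ) ⊕ g(δ) for all σ, δ, and let h : List D → D, h(x) = List.foldl ⊕ (f []) x, be its summarized version. Suppose h' : List D → D × D' is a ⊙-homomorphic lifting of h, i.e., h'(x • y) = h'(x) ⊙ h'(y) for all x, y : List D and Prod.fst ∘ h' = h. Define f' : List β → D × D' by f'(σ) = h'(σ.map g). Then f' is a ⊙-homomorphic lifting of f: f'(σ • σ') = f'(σ) ⊙ f'(σ') for all σ, σ' : List β, and Prod.fst ∘ f' = f. -/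
theorem lift_summarized_to_lift_original {β D D' : Type*}
    (f : List β → D) (g : β → D) (op : D → D → D)
    (hmem : ∀ (σ : List β) (δ : β), f (σ ++ [δ]) = op (f σ) (g δ))
    (h' : List D → D × D') (odot : D × D' → D × D' → D × D')
    (hhom : ∀ x y : List D, h' (x ++ y) = odot (h' x) (h' y))
    (hlift : Prod.fst ∘ h' = fun x => List.foldl op (f []) x) :
    (∀ σ σ' : List β,
      (fun σ : List β => h' (σ.map g)) (σ ++ σ') =
        odot ((fun σ : List β => h' (σ.map g)) σ)
          ((fun σ : List β => h' (σ.map g)) σ')) ∧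
    Prod.fst ∘ (fun σ : List β => h' (σ.map g)) = f := by
  refine ⟨fun σ σ' => ?_, ?_⟩
  · simp only [List.map_append]
    exact hhom _ _
  · funext σ
    have h1 : (h' (σ.map g)).1 = List.foldl op (f []) (σ.map g) := congrFun hlift (σ.map g)
    have h2 : ∀ τ : List β, List.foldl op (f []) (τ.map g) = f τ := by
      intro τ
      induction τ using List.reverseRecOn with
      | nil => rfl
      | append_singleton τ δ ih =>
        rw [List.map_append, List.foldl_append, ih, hmem]
        rfl
    exact h1.trans (h2 σ)
end

section
/- Let f : List β → D be memoryless via g : β → D and ⊕ : D → D → D, i.e., f(σ • [δ]) = f(σ) ⊕ g(δ) for all σ, δ, and let h : List D → D, h(x) = List.foldl ⊕ (f []) x, be its summarized version. Suppose f' : List β → D × D' is a ⊙-homomorphic lifting of f, i.e., f'(σ • σ') = f'(σ) ⊙ f'(σ') for all σ, σ' and Prod.fst ∘ f' = f, and suppose g has a right inverse s : D → β, i.e., g(s(d)) = d for all d : D. Define h' : List D → D × D' by h'(x) = f'(x.map s). Then h' is a ⊙-homomorphic lifting of h: h'(x • y) = h'(x) ⊙ h'(y) for all x, y : List D, and Prod.fst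 ∘ h' = h. -/
theorem lift_original_to_lift_summarized {β D D' : Type*}
    (f : List β → D) (g : β → D) (op : D → D → D)
    (hmem : ∀ (σ : List β) (δ : β), f (σ ++ [δ]) = op (f σ) (g δ))
    (f' : List β → D × D') (odot : D × D' → D × D' → D × D')
    (hhom : ∀ σ σ' : List β, f' (σ ++ σ') = odot (f' σ) (f' σ'))
    (hlift : Prod.fst ∘ f' = f)
    (s : D → β) (hs : ∀ d : D, g (s d) = d) :
    (∀ x y : List D,
      (fun x : List D => f' (x.map s)) (x ++ y) =
        odot ((fun x : List D => f' (x.map s)) x)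
          ((fun x : List D => f' (x.map s)) y)) ∧
    Prod.fst ∘ (fun x : List D => f' (x.map s)) =
      fun x : List D => List.foldl op (f []) x := by
  refine ⟨fun x y => ?_, ?_⟩
  · show f' ((x ++ y).map s) = odot (f' (x.map s)) (f' (y.map s))
    rw [List.map_append, hhom]
  · funext x
    have h1 : ∀ σ, (f' σ).1 = f σ := fun σ => congrFun hlift σ
    show (f' (x.map s)).1 = List.foldl op (f []) x
    rw [h1]
    induction x using List.reverseRecOn with
    | nil => rfl
    | append_singleton l a ih =>
      rw [List.map_append, List.map_singleton, hmem, hs, ih, List.foldl_append]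
      rfl
end

section
/- Let h : List α → D be given by a left fold, h(x) = List.foldl ⊕ e x for some ⊕ : D → α → D and e : D. Suppose h' : List α → D × D' is a ⊙-homomorphic lifting of h, i.e., h'(x • y) = h'(x) ⊙ h'(y) for all x, y : List α and Prod.fst ∘ h' = h. Then the first component of the join does not depend on the second component of its left argument: for all x₁, x₂, y : List α, if Prod.fst (h'(x₁)) = Prod.fst (h'(x₂)) then Prod.fst (h'(x₁) ⊙ h'(y)) = Prod.fst (h'(x₂) ⊙ h'(y)). -/
theorem join_fst_independent_of_left_aux {α D D' : Type*}
    (op : D → α → D) (e : D)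
    (h' : List α → D × D') (odot : D × D' → D × D' → D × D')
    (hhom : ∀ x y : List α, h' (x ++ y) = odot (h' x) (h' y))
    (hlift : Prod.fst ∘ h' = fun x => List.foldl op e x) :
    ∀ x₁ x₂ y : List α, (h' x₁).1 = (h' x₂).1 →
      (odot (h' x₁) (h' y)).1 = (odot (h' x₂) (h' y)).1 := by
  intro x₁ x₂ y h
  have hl : ∀ x, (h' x).1 = List.foldl op e x := fun x => congrFun hlift x
  rw [hl, hl] at h
  rw [← hhom, ← hhom, hl, hl, List.foldl_append, List.foldl_append, h]
end

section
/- Let ⊖ : D → γ → D, and for each d : D let G(d) : List γ → D be given by G(d)(δ) = List.foldl ⊖ d δ. Fix e : D and a binary operator ⊙ : D → D → D, and suppose G(e) has a weak inverse, i.e., there is w : D → List γ with G(e)(w(d)) = d for all d : D. If G(e) is ⊙-homomorphic, i.e., G(e)(δ • δ') = G(e)(δ) ⊙ G(e)(δ') for all δ, δ' : List γ, then G is a family of ⊙-homomorphisms with base point e: for all d : D and δ, δ' : List γ, G(d)(δ • δ') = G(d)(δ) ⊙ G(e)(δ'). -/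
theorem base_hom_implies_family_hom {γ D : Type*}
    (om : D → γ → D) (e : D) (odot : D → D → D)
    (w : D → List γ) (hw : ∀ d : D, List.foldl om e (w d) = d)
    (hhom : ∀ δ δ' : List γ,
      List.foldl om e (δ ++ δ') =
        odot (List.foldl om e δ) (List.foldl om e δ')) :
    ∀ (d : D) (δ δ' : List γ),
      List.foldl om d (δ ++ δ') =
        odot (List.foldl om d δ) (List.foldl om e δ') := by
  intro d δ δ'
  have h := hhom (w d ++ δ) δ'
  simp only [List.foldl_append, hw] at h
  rw [List.foldl_append]
  exact h
end

section
/- Let h : List α → D be ⊙-homomorphic, i.e., h(x • y) = h(x) ⊙ h(y) for all x, y : List α. Then h is the composition of a map and a reduction: for every x : List α, h(x) = List.foldl ⊙ (h []) (x.map (fun a => h [a])). -/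
theorem hom_is_map_reduce {α D : Type*} (h : List α → D) (odot : D → D → D)
    (hhom : ∀ x y : List α, h (x ++ y) = odot (h x) (h y)) :
    ∀ x : List α, h x = List.foldl odot (h []) (x.map fun a => h [a]) := by
  intro x
  induction x using List.reverseRecOn with
  | nil => rfl
  | append_singleton xs a ih =>
    rw [hhom, List.map_append, List.foldl_append, ← ih]
    rfl
end
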